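/- There exists a ℂ-linear map ∇ : O → O which is a local derivation of the ternary Malcev algebra M_8 but is not a derivation of M_8. -/

import Mathlib

noncomputable section

/-- The complex octonions, realized by the Cayley–Dickson construction as
pairs of complex quaternions. -/
abbrev Oct : Type := Quaternion ℂ × Quaternion ℂ

namespace Oct

/-- Octonion multiplication: `(p,q)(r,s) = (pr − s̄q, sp + qr̄)`. -/
def mul (x y : Oct) : Oct :=
  (x.1 * y.1 - star y.2 * x.2, y.2 * x.1 + x.2 * star y.1)

/-- Octonion conjugation: `(p,q) ↦ (p̄, −q)`. -/
def conj (x : Oct) : Oct := (star x.1, -x.2)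

/-- The octonion unit `1 = (1,0)`. -/
def one : Oct := (1, 0)

/-- The symmetric bilinear form `⟨·,·⟩` on the octonions, defined by
`x ȳ + y x̄ = 2 ⟨x,y⟩ · 1` (the left-hand side always lies in `ℂ·1`). -/
def form (x y : Oct) : ℂ := ((mul x (conj y) + mul y (conj x)).1).re / 2

/-- The ternary Malcev product on `M₈`:
`[x,y,z] = (x ȳ) z − ⟨y,z⟩ x + ⟨x,z⟩ y − ⟨x,y⟩ z`. -/
def tmul (x y z : Oct) : Oct :=
  mul (mul x (conj y)) z - form y z • x + form x z • y - form x y • z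

/-- A derivation of the ternary Malcev algebra `M₈`. -/
def IsDer (D : Oct →ₗ[ℂ] Oct) : Prop :=
  ∀ x y z : Oct, D (tmul x y z) = tmul (D x) y z + tmul x (D y) z + tmul x y (D z)

/-- A local derivation of the ternary Malcev algebra `M₈`. -/
def IsLocDer (T : Oct →ₗ[ℂ] Oct) : Prop :=
  ∀ x : Oct, ∃ D : Oct →ₗ[ℂ] Oct, IsDer D ∧ T x = D x

end Oct

namespace Oct

theorem mul_coords (x y : Oct) :
    (mul x y).1.re =
    x.1.re * y.1.re - x.1.imI * y.1.imI - x.1.imJ * y.1.imJ - x.1.imK * y.1.imK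
    - y.2.re * x.2.re - y.2.imI * x.2.imI - y.2.imJ * x.2.imJ - y.2.imK * x.2.imK ∧
    (mul x y).1.imI =
    x.1.re * y.1.imI + x.1.imI * y.1.re + x.1.imJ * y.1.imK - x.1.imK * y.1.imJ
    - y.2.re * x.2.imI + y.2.imI * x.2.re + y.2.imJ * x.2.imK - y.2.imK * x.2.imJ ∧
    (mul x y).1.imJ =
    x.1.re * y.1.imJ - x.1.imI * y.1.imK + x.1.imJ * y.1.re + x.1.imK * y.1.imI
    - y.2.re * x.2.imJ - y.2.imI * x.2.imK + y.2.imJ * x.2.re + y.2.imK * x.2.imI ∧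
    (mul x y).1.imK =
    x.1.re * y.1.imK + x.1.imI * y.1.imJ - x.1.imJ * y.1.imI + x.1.imK * y.1.re
    - y.2.re * x.2.imK + y.2.imI * x.2.imJ - y.2.imJ * x.2.imI + y.2.imK * x.2.re ∧
    (mul x y).2.re =
    y.2.re * x.1.re - y.2.imI * x.1.imI - y.2.imJ * x.1.imJ - y.2.imK * x.1.imK
    + x.2.re * y.1.re + x.2.imI * y.1.imI + x.2.imJ * y.1.imJ + x.2.imK * y.1.imK ∧
    (mul x y).2.imI =
    y.2.re * x.1.imI + y.2.imI * x.1.re + y.2.imJ * x.1.imK - y.2.imK * x.1.imJ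
    - x.2.re * y.1.imI + x.2.imI * y.1.re - x.2.imJ * y.1.imK + x.2.imK * y.1.imJ ∧
    (mul x y).2.imJ =
    y.2.re * x.1.imJ - y.2.imI * x.1.imK + y.2.imJ * x.1.re + y.2.imK * x.1.imI
    - x.2.re * y.1.imJ + x.2.imI * y.1.imK + x.2.imJ * y.1.re - x.2.imK * y.1.imI ∧
    (mul x y).2.imK =
    y.2.re * x.1.imK + y.2.imI * x.1.imJ - y.2.imJ * x.1.imI + y.2.imK * x.1.re
    - x.2.re * y.1.imK - x.2.imI * y.1.imJ + x.2.imJ * y.1.imI + x.2.imK * y.1.re := by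
  refine ⟨?_, ?_, ?_, ?_, ?_, ?_, ?_, ?_⟩ <;> simp [mul] <;> ring

theorem add_coords (x y : Oct) :
    (x + y).1.re = x.1.re + y.1.re ∧
    (x + y).1.imI = x.1.imI + y.1.imI ∧
    (x + y).1.imJ = x.1.imJ + y.1.imJ ∧
    (x + y).1.imK = x.1.imK + y.1.imK ∧
    (x + y).2.re = x.2.re + y.2.re ∧
    (x + y).2.imI = x.2.imI + y.2.imI ∧
    (x + y).2.imJ = x.2.imJ + y.2.imJ ∧
    (x + y).2.imK = x.2.imK + y.2.imK := by
  exact ⟨rfl, rfl, rfl, rfl, rfl, rfl, rfl, rfl⟩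

theorem sub_coords (x y : Oct) :
    (x - y).1.re = x.1.re - y.1.re ∧
    (x - y).1.imI = x.1.imI - y.1.imI ∧
    (x - y).1.imJ = x.1.imJ - y.1.imJ ∧
    (x - y).1.imK = x.1.imK - y.1.imK ∧
    (x - y).2.re = x.2.re - y.2.re ∧
    (x - y).2.imI = x.2.imI - y.2.imI ∧
    (x - y).2.imJ = x.2.imJ - y.2.imJ ∧
    (x - y).2.imK = x.2.imK - y.2.imK := by
  simp

theorem smul_coords (c : ℂ) (x : Oct) :
    (c • x).1.re = c * x.1.re ∧
    (c • x).1.imI = c * x.1.imI ∧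
    (c • x).1.imJ = c * x.1.imJ ∧
    (c • x).1.imK = c * x.1.imK ∧
    (c • x).2.re = c * x.2.re ∧
    (c • x).2.imI = c * x.2.imI ∧
    (c • x).2.imJ = c * x.2.imJ ∧
    (c • x).2.imK = c * x.2.imK := by
  exact ⟨rfl, rfl, rfl, rfl, rfl, rfl, rfl, rfl⟩

theorem conj_coords (x : Oct) :
    (conj x).1.re = x.1.re ∧
    (conj x).1.imI = -x.1.imI ∧
    (conj x).1.imJ = -x.1.imJ ∧
    (conj x).1.imK = -x.1.imK ∧
    (conj x).2.re = -x.2.re ∧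
    (conj x).2.imI = -x.2.imI ∧
    (conj x).2.imJ = -x.2.imJ ∧
    (conj x).2.imK = -x.2.imK := by
  simp [conj]

theorem one_coords :
    one.1.re = 1 ∧
    one.1.imI = 0 ∧
    one.1.imJ = 0 ∧
    one.1.imK = 0 ∧
    one.2.re = 0 ∧
    one.2.imI = 0 ∧
    one.2.imJ = 0 ∧
    one.2.imK = 0 := by
  exact ⟨rfl, rfl, rfl, rfl, rfl, rfl, rfl, rfl⟩

protected theorem zero_smul (x : Oct) : (0 : ℂ) • x = 0 := by module

protected theorem neg_eq_smul (x : Oct) : -x = (-1 : ℂ) • x := by module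

theorem form_eq (x y : Oct) : form x y =
    x.1.re * y.1.re + x.1.imI * y.1.imI + x.1.imJ * y.1.imJ + x.1.imK * y.1.imK +
    (x.2.re * y.2.re + x.2.imI * y.2.imI + x.2.imJ * y.2.imJ + x.2.imK * y.2.imK) := by
  simp [form, mul, conj]
  ring

theorem form_comm (x y : Oct) : form x y = form y x := by
  simp only [form_eq]; ring

theorem form_add_left (x y z : Oct) : form (x + y) z = form x z + form y z := by
  simp only [form_eq, add_coords]; ring

theorem form_smul_left (c : ℂ) (x y : Oct) : form (c • x) y = c * form x y := by
  simp only [form_eq, smul_coords]; ring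

theorem form_sub_left (x y z : Oct) : form (x - y) z = form x z - form y z := by
  simp only [form_eq, sub_coords]; ring

theorem form_add_right (x y z : Oct) : form x (y + z) = form x y + form x z := by
  simp only [form_comm x, form_add_left]

theorem form_smul_right (c : ℂ) (x y : Oct) : form x (c • y) = c * form x y := by
  simp only [form_comm x, form_smul_left]

theorem form_conj_conj (x y : Oct) : form (conj x) (conj y) = form x y := by
  simp only [form_eq, conj_coords]; ring

theorem exists_form_eq_one {x : Oct} (hx : x ≠ 0) : ∃ y, form x y = 1 := by
  obtain ⟨y, hy⟩ : ∃ y, form x y ≠ 0 := by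
    by_contra! h
    apply hx
    ext
    · change x.1.re = 0
      simpa [form_eq] using h (⟨1, 0, 0, 0⟩, ⟨0, 0, 0, 0⟩)
    · change x.1.imI = 0
      simpa [form_eq] using h (⟨0, 1, 0, 0⟩, ⟨0, 0, 0, 0⟩)
    · change x.1.imJ = 0
      simpa [form_eq] using h (⟨0, 0, 1, 0⟩, ⟨0, 0, 0, 0⟩)
    · change x.1.imK = 0
      simpa [form_eq] using h (⟨0, 0, 0, 1⟩, ⟨0, 0, 0, 0⟩)
    · change x.2.re = 0
      simpa [form_eq] using h (⟨0, 0, 0, 0⟩, ⟨1, 0, 0, 0⟩)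
    · change x.2.imI = 0
      simpa [form_eq] using h (⟨0, 0, 0, 0⟩, ⟨0, 1, 0, 0⟩)
    · change x.2.imJ = 0
      simpa [form_eq] using h (⟨0, 0, 0, 0⟩, ⟨0, 0, 1, 0⟩)
    · change x.2.imK = 0
      simpa [form_eq] using h (⟨0, 0, 0, 0⟩, ⟨0, 0, 0, 1⟩)
  exact ⟨(form x y)⁻¹ • y, by rw [form_smul_right, inv_mul_cancel₀ hy]⟩

protected theorem mul_add (x y z : Oct) : mul x (y + z) = mul x y + mul x z := by
  ext <;> simp only [mul_coords, add_coords] <;> ring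

protected theorem add_mul (x y z : Oct) : mul (x + y) z = mul x z + mul y z := by
  ext <;> simp only [mul_coords, add_coords] <;> ring

protected theorem mul_sub (x y z : Oct) : mul x (y - z) = mul x y - mul x z := by
  ext <;> simp only [mul_coords, sub_coords] <;> ring

protected theorem sub_mul (x y z : Oct) : mul (x - y) z = mul x z - mul y z := by
  ext <;> simp only [mul_coords, sub_coords] <;> ring

theorem smul_mul (c : ℂ) (x y : Oct) : mul (c • x) y = c • mul x y := by
  ext <;> simp only [mul_coords, smul_coords] <;> ring

theorem mul_smul (c : ℂ) (x y : Oct) : mul x (c • y) = c • mul x y := by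
  ext <;> simp only [mul_coords, smul_coords] <;> ring

protected theorem one_mul (x : Oct) : mul one x = x := by
  ext <;> simp only [mul_coords, one_coords] <;> ring

protected theorem mul_one (x : Oct) : mul x one = x := by
  ext <;> simp only [mul_coords, one_coords] <;> ring

theorem conj_add (x y : Oct) : conj (x + y) = conj x + conj y := by
  ext <;> simp only [conj_coords, add_coords] <;> ring

theorem conj_sub (x y : Oct) : conj (x - y) = conj x - conj y := by
  ext <;> simp only [conj_coords, sub_coords] <;> ring

theorem conj_smul (c : ℂ) (x : Oct) : conj (c • x) = c • conj x := by
  ext <;> simp only [conj_coords, smul_coords] <;> ring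

theorem conj_mul (x y : Oct) : conj (mul x y) = mul (conj y) (conj x) := by
  ext <;> simp only [conj_coords, mul_coords] <;> ring

theorem conj_conj (x : Oct) : conj (conj x) = x := by
  ext <;> simp only [conj_coords] <;> ring

theorem conj_eq (x : Oct) : conj x = (2 * form one x) • one - x := by
  ext <;> simp only [conj_coords, sub_coords, smul_coords, one_coords, form_eq] <;> ring

theorem mul_conj_add_mul_conj (x y : Oct) :
    mul x (conj y) + mul y (conj x) = (2 * form x y) • one := by
  ext <;> simp only [mul_coords, conj_coords, add_coords, smul_coords, one_coords, form_eq] <;> ring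

theorem mul_conj_self (x : Oct) : mul x (conj x) = form x x • one := by
  ext <;> simp only [mul_coords, conj_coords, smul_coords, one_coords, form_eq] <;> ring

/-- The associator changes sign when its first two arguments are exchanged. -/
theorem mul_mul_left (a x y : Oct) :
    mul a (mul x y) = mul (mul a x) y + mul (mul x a) y - mul x (mul a y) := by
  ext <;> simp only [mul_coords, add_coords, sub_coords] <;> ring

/-- The associator changes sign when its last two arguments are exchanged. -/
theorem mul_mul_right (a x y : Oct) :
    mul (mul x y) a = mul x (mul y a) + mul x (mul a y) - mul (mul x a) y := by
  ext <;> simp only [mul_coords, add_coords, sub_coords] <;> ring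

theorem mul_conj_mul_add (x y z : Oct) :
    mul y (mul (conj x) z) + mul x (mul (conj y) z) = (2 * form x y) • z := by
  ext <;> simp only [mul_coords, conj_coords, add_coords, smul_coords, form_eq] <;> ring

theorem conj_mul_mul_self (x z : Oct) : mul (conj x) (mul x z) = form x x • z := by
  ext <;> simp only [mul_coords, conj_coords, smul_coords, form_eq] <;> ring

theorem mul_conj_mul_self (x z : Oct) : mul (mul z (conj x)) x = form x x • z := by
  ext <;> simp only [mul_coords, conj_coords, smul_coords, form_eq] <;> ring

theorem form_mul_left (a x y : Oct) : form (mul a x) y = form x (mul (conj a) y) := by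
  simp only [form_eq, mul_coords, conj_coords]; ring

theorem form_mul_right (a x y : Oct) : form (mul x a) y = form x (mul y (conj a)) := by
  simp only [form_eq, mul_coords, conj_coords]; ring

theorem tmul_lin_left (c d : ℂ) (x x' y z : Oct) :
    tmul (c • x + d • x') y z = c • tmul x y z + d • tmul x' y z := by
  simp only [tmul, Oct.add_mul, smul_mul, form_add_left, form_smul_left]
  module

theorem tmul_lin_mid (c d : ℂ) (x y y' z : Oct) :
    tmul x (c • y + d • y') z = c • tmul x y z + d • tmul x y' z := by
  simp only [tmul, conj_add, conj_smul, Oct.mul_add, mul_smul, Oct.add_mul, smul_mul,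
    form_add_left, form_smul_left, form_add_right, form_smul_right]
  module

theorem tmul_lin_right (c d : ℂ) (x y z z' : Oct) :
    tmul x y (c • z + d • z') = c • tmul x y z + d • tmul x y z' := by
  simp only [tmul, Oct.mul_add, mul_smul, form_add_right, form_smul_right]
  module

theorem IsDer.lin {D E : Oct →ₗ[ℂ] Oct} (hD : IsDer D) (hE : IsDer E) (c d : ℂ) :
    IsDer (c • D + d • E) := by
  intro x y z
  simp only [LinearMap.add_apply, LinearMap.smul_apply, tmul_lin_left, tmul_lin_mid,
    tmul_lin_right, hD x y z, hE x y z]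
  module

theorem IsDer.commutator {D E : Oct →ₗ[ℂ] Oct} (hD : IsDer D) (hE : IsDer E) :
    IsDer ((1 : ℂ) • (D ∘ₗ E) + (-1 : ℂ) • (E ∘ₗ D)) := by
  intro x y z
  simp only [LinearMap.add_apply, LinearMap.smul_apply, LinearMap.comp_apply, tmul_lin_left,
    tmul_lin_mid, tmul_lin_right, hD _ _ _, hE _ _ _, map_add]
  module

theorem isDer_of_skew {D : Oct →ₗ[ℂ] Oct} (hskew : ∀ x y, form x (D y) = -form (D x) y)
    (hD : ∀ x y z, D (mul (mul x (conj y)) z) = mul (mul (D x) (conj y)) z +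
      mul (mul x (conj (D y))) z + mul (mul x (conj y)) (D z)) : IsDer D := by
  intro x y z
  simp only [tmul, map_sub, map_add, map_smul, hD, hskew]
  module

/-- The component in `𝔰𝔬(7)` of the rotation in the plane of `u` and `w`. -/
def rot (u w : Oct) : Oct →ₗ[ℂ] Oct where
  toFun z := tmul u w z + (3 : ℂ) • (form u z • w - form w z • u)
  map_add' z z' := by
    have := tmul_lin_right 1 1 u w z z'
    simp only [one_smul] at this
    rw [this, form_add_right, form_add_right]
    module
  map_smul' c z := by
    have := tmul_lin_right c 0 u w z z
    simp only [Oct.zero_smul, add_zero] at this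
    rw [this, form_smul_right, form_smul_right, RingHom.id_apply]
    module

theorem rot_apply (u w z : Oct) :
    rot u w z = tmul u w z + (3 : ℂ) • (form u z • w - form w z • u) := rfl

theorem rot_lin_left (c d : ℂ) (u u' w z : Oct) :
    rot (c • u + d • u') w z = c • rot u w z + d • rot u' w z := by
  simp only [rot_apply, tmul_lin_left, form_add_left, form_smul_left]
  module

theorem rot_one_apply (a z : Oct) :
    rot one a z = mul a z + (2 : ℂ) • mul z a - (3 * form one a) • z := by
  rw [rot_apply, tmul, Oct.one_mul]
  ext <;> simp only [mul_coords, conj_coords, add_coords, sub_coords, smul_coords, one_coords,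
    form_eq] <;> ring

theorem form_rot_one (a x y : Oct) : form x (rot one a y) = -form (rot one a x) y := by
  simp only [rot_one_apply, form_eq, mul_coords, add_coords, sub_coords, smul_coords, one_coords]
  ring

theorem isDer_rot_one (a : Oct) : IsDer (rot one a) := by
  refine isDer_of_skew (form_rot_one a) fun x y z => ?_
  simp only [rot_one_apply]
  rw [mul_mul_left a (mul x (conj y)) z, mul_mul_right a (mul x (conj y)) z,
    mul_mul_left a x (conj y), mul_mul_right a x (conj y)]
  simp only [Oct.add_mul, Oct.sub_mul, Oct.mul_add, Oct.mul_sub, smul_mul, mul_smul, conj_add,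
    conj_sub, conj_smul, conj_mul, conj_eq a, Oct.mul_one, Oct.one_mul]
  module

theorem IsDer.map_rot {D : Oct →ₗ[ℂ] Oct} (hD : IsDer D)
    (hskew : ∀ x y, form x (D y) = -form (D x) y) (u w z : Oct) :
    D (rot u w z) = rot (D u) w z + rot u (D w) z + rot u w (D z) := by
  simp only [rot_apply, map_add, map_sub, map_smul, hD u w z, hskew]
  module

theorem isDer_rot (u w : Oct) : IsDer (rot u w) := by
  have h_comm := (isDer_rot_one u).commutator (isDer_rot_one w)
  have h_eq : rot u w = (1 : ℂ) • ((1 / 3 : ℂ) • ((1 : ℂ) • (rot one u ∘ₗ rot one w) +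
      (-1 : ℂ) • (rot one w ∘ₗ rot one u)) + (-1 / 3 : ℂ) • rot one (rot one u w)) +
      form one u • rot one w := by
    refine LinearMap.ext fun z => ?_
    have h_map := (isDer_rot_one u).map_rot (form_rot_one u) one w z
    have h_one : rot one u one = (3 : ℂ) • u + (-3 * form one u) • one := by
      rw [rot_one_apply, Oct.mul_one, Oct.one_mul]
      module
    rw [h_one, rot_lin_left] at h_map
    simp only [LinearMap.add_apply, LinearMap.smul_apply, LinearMap.comp_apply, h_map]
    module
  rw [h_eq]
  exact (h_comm.lin (isDer_rot_one _) _ _).lin (isDer_rot_one _) _ _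

theorem mul_conj_eq_neg {x y : Oct} (h : form x y = 0) : mul x (conj y) = -mul y (conj x) := by
  rw [eq_neg_iff_add_eq_zero, mul_conj_add_mul_conj, h, mul_zero, Oct.zero_smul]

theorem rot_self_apply {x v : Oct} (h : form x v = 0) : rot x v x = (3 * form x x) • v := by
  have h' : form v x = 0 := by rw [form_comm, h]
  have h_mul : mul (mul x (conj v)) x = -(form x x • v) := by
    rw [mul_conj_eq_neg h, Oct.neg_eq_smul, smul_mul, mul_conj_mul_self, Oct.neg_eq_smul]
  rw [rot_apply, tmul, h_mul, h, h']
  module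

theorem rot_apply_right {x y : Oct} (hx : form x x = 0) (hxy : form x y = 1) :
    rot y x x = (3 : ℂ) • x := by
  rw [rot_apply, tmul, mul_conj_mul_self, hx, form_comm y x, hxy]
  module

theorem rot_apply_of_orthogonal {x y v : Oct} (hxy : form x y = 1) (hx : form v x = 0)
    (hy : form v y = 0) : rot y v x = mul (mul y (conj v)) x + (4 : ℂ) • v := by
  rw [rot_apply, tmul, hx, form_comm y x, hxy, form_comm y v, hy]
  module

theorem mul_mul_conj_twice {x y v : Oct} (hxx : form x x = 0) (hxy : form x y = 1)
    (hx : form v x = 0) (hy : form v y = 0) :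
    mul (mul y (conj (mul (mul y (conj v)) x))) x = (-2 : ℂ) • mul (mul y (conj v)) x := by
  have h1 : mul y (mul (conj x) (mul v (conj y))) =
      (2 : ℂ) • mul v (conj y) - mul x (mul (conj y) (mul v (conj y))) := by
    rw [eq_sub_iff_add_eq, mul_conj_mul_add, hxy, mul_one]
  have h2 : mul v (conj y) = (-1 : ℂ) • mul y (conj v) := by
    rw [mul_conj_eq_neg hy, Oct.neg_eq_smul]
  have h3 : mul (mul x (conj v)) x = 0 := by
    rw [mul_conj_eq_neg (by rw [form_comm, hx]), Oct.neg_eq_smul, smul_mul, mul_conj_mul_self,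
      hxx]
    module
  rw [conj_mul, conj_mul, conj_conj, h1, h2, mul_smul, conj_mul_mul_self, mul_smul, mul_smul,
    Oct.sub_mul, smul_mul, smul_mul, smul_mul, smul_mul, h3]
  module

theorem exists_isDer_apply_eq {x v : Oct} (h0 : x ≠ 0) (hv : form x v = 0) :
    ∃ D, IsDer D ∧ D x = v := by
  by_cases hxx : form x x = 0
  · obtain ⟨y, hxy⟩ := exists_form_eq_one h0
    set w := v - form v y • x with hw
    have hwx : form w x = 0 := by
      rw [hw, form_sub_left, form_smul_left, form_comm v, hv, hxx, mul_zero, sub_zero]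
    have hwy : form w y = 0 := by
      rw [hw, form_sub_left, form_smul_left, hxy, mul_one, sub_self]
    set g := mul (mul y (conj w)) x with hg
    have hgx : form g x = 0 := by
      rw [hg, form_mul_right, mul_conj_self, hxx, form_smul_right, zero_mul]
    have hgy : form g y = 0 := by
      rw [hg, form_mul_right, form_mul_left, conj_mul_mul_self, form_smul_right, form_conj_conj,
        hwx, mul_zero]
    refine ⟨(1 : ℂ) • ((1 / 4 : ℂ) • rot y w + (-1 / 8 : ℂ) • rot y g) +
      (form v y / 3) • rot y x,
      ((isDer_rot _ _).lin (isDer_rot _ _) _ _).lin (isDer_rot _ _) _ _, ?_⟩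
    simp only [LinearMap.add_apply, LinearMap.smul_apply, rot_apply_right hxx hxy,
      rot_apply_of_orthogonal hxy hwx hwy, rot_apply_of_orthogonal hxy hgx hgy]
    rw [hg, mul_mul_conj_twice hxx hxy hwx hwy, ← hg, hw]
    module
  · refine ⟨(1 / (3 * form x x)) • rot x v + (0 : ℂ) • rot x v,
      (isDer_rot _ _).lin (isDer_rot _ _) _ _, ?_⟩
    rw [zero_smul, add_zero, LinearMap.smul_apply, rot_self_apply hv, smul_smul,
      one_div_mul_cancel (by simpa using hxx), one_smul]

theorem isLocDer_of_skew {T : Oct →ₗ[ℂ] Oct} (hT : ∀ x, form x (T x) = 0) : IsLocDer T := by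
  intro x
  by_cases hx : x = 0
  · exact ⟨rot 0 0, isDer_rot 0 0, by rw [hx, map_zero, map_zero]⟩
  · obtain ⟨D, hD, h⟩ := exists_isDer_apply_eq hx (hT x)
    exact ⟨D, hD, h.symm⟩

/-- The rotation `z ↦ ⟨u,z⟩w − ⟨w,z⟩u` in the plane of `u` and `w`. -/
def planeRot (u w : Oct) : Oct →ₗ[ℂ] Oct where
  toFun z := form u z • w - form w z • u
  map_add' z z' := by
    rw [form_add_right, form_add_right]
    module
  map_smul' c z := by
    rw [form_smul_right, form_smul_right, RingHom.id_apply]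
    module

theorem planeRot_apply (u w z : Oct) : planeRot u w z = form u z • w - form w z • u := rfl

theorem isLocDer_planeRot (u w : Oct) : IsLocDer (planeRot u w) :=
  isLocDer_of_skew fun x => by
    rw [planeRot_apply, form_comm, form_sub_left, form_smul_left, form_smul_left]
    ring

theorem not_isDer_planeRot : ¬ IsDer (planeRot one (⟨0, 1, 0, 0⟩, ⟨0, 0, 0, 0⟩)) := by
  intro h
  have h_eq := congrArg (fun t : Oct => t.2.imK)
    (h one (⟨0, 0, 1, 0⟩, ⟨0, 0, 0, 0⟩) (⟨0, 0, 0, 0⟩, ⟨1, 0, 0, 0⟩))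
  simp only [planeRot_apply, tmul, sub_coords, add_coords, smul_coords, mul_coords, conj_coords,
    one_coords, form_eq] at h_eq
  norm_num at h_eq

end Oct

open Oct in
/-- The ternary Malcev algebra `M₈` admits a pure local derivation: a local
derivation which is not a derivation. -/
theorem exists_local_derivation_not_derivation :
    ∃ nabla : Oct →ₗ[ℂ] Oct, IsLocDer nabla ∧ ¬ IsDer nabla := by
  exact ⟨_, isLocDer_planeRot _ _, not_isDer_planeRot⟩
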